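/- Fix β ∈ (0,1) and set x_n = ⌊n^β⌋. Then the differential entropy of f_{n,x_n} satisfies lim_{n→∞} [ h(f_{n,x_n}) − (1/2)·log( 2πe·(1−n^{β−1})/n^{2−β} ) ] = 0; equivalently, the differential entropy of the density of the standardized variable Z̃_n = n^{1−β/2}·(Z_n − n^{β−1}), where Z_n has density f_{n,x_n}, converges to (1/2)·log(2πe) as n → ∞. -/

import Mathlib

open MeasureTheory Real Filter

/-- The Beta(x+1, n-x+1) posterior density `f_{n,x}` on `[0,1]`, extended by `0` outside. -/
noncomputable def betaDensity (n x : ℕ) (p : ℝ) : ℝ :=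
  if 0 ≤ p ∧ p ≤ 1 then ((n : ℝ) + 1) * (n.choose x : ℝ) * p ^ x * (1 - p) ^ (n - x) else 0

/-- Differential entropy `h(f) = -∫ f log f`. -/
noncomputable def diffEntropy (f : ℝ → ℝ) : ℝ :=
  -∫ z : ℝ, f z * Real.log (f z)

/-- Density of the standardized variable `Z̃_n = n^{1-β/2} (Z_n - n^{β-1})` where `Z_n`
has density `f_{n, ⌊n^β⌋}`. -/
noncomputable def tildeDensityBeta (β : ℝ) (n : ℕ) (z : ℝ) : ℝ :=
  (n : ℝ) ^ (β / 2 - 1) *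
    betaDensity n (Nat.floor ((n : ℝ) ^ β))
      ((n : ℝ) ^ (β - 1) + (n : ℝ) ^ (β / 2 - 1) * z)

lemma intervalIntegrable_pow_mul_log (a b : ℕ) :
    IntervalIntegrable (fun p : ℝ => p ^ a * (1 - p) ^ b * log p) volume 0 1 :=
  intervalIntegral.intervalIntegrable_log'.continuousOn_mul (by fun_prop)

lemma integral_pow_mul_one_sub_pow (a b : ℕ) :
    ∫ p in (0 : ℝ)..1, p ^ a * (1 - p) ^ b =
      (a.factorial * b.factorial : ℝ) / (a + b + 1).factorial := by
  induction b generalizing a with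
  | zero =>
    simp [Nat.factorial_succ]
    field_simp
  | succ b ih =>
    have h : ∀ p : ℝ, p ^ a * (1 - p) ^ (b + 1) =
        p ^ a * (1 - p) ^ b - p ^ (a + 1) * (1 - p) ^ b := fun p => by ring
    simp_rw [h]
    rw [intervalIntegral.integral_sub (Continuous.intervalIntegrable (by fun_prop) _ _)
      (Continuous.intervalIntegrable (by fun_prop) _ _), ih, ih,
      show a + 1 + b + 1 = a + b + 1 + 1 by ring, show a + (b + 1) + 1 = a + b + 1 + 1 by ring]
    simp only [Nat.factorial_succ]
    push_cast
    field_simp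
    ring

lemma integral_pow_mul_log (a : ℕ) :
    ∫ p in (0 : ℝ)..1, p ^ a * log p = -1 / ((a : ℝ) + 1) ^ 2 := by
  have h0 : ((a : ℝ) + 1) ≠ 0 := by positivity
  have hc : ContinuousOn (fun p : ℝ => p ^ a * (p * log p) / (a + 1) - p ^ (a + 1) / (a + 1) ^ 2)
      (Set.Icc 0 1) := by
    have := continuous_mul_log
    fun_prop
  have hd : ∀ p ∈ Set.Ioo (0 : ℝ) 1, HasDerivAt
      (fun p : ℝ => p ^ a * (p * log p) / (a + 1) - p ^ (a + 1) / (a + 1) ^ 2)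
      (p ^ a * log p) p := by
    intro p hp
    have hp0 : p ≠ 0 := hp.1.ne'
    have h1 : HasDerivAt (fun p : ℝ => p ^ (a + 1) * log p / (a + 1) - p ^ (a + 1) / (a + 1) ^ 2)
        (((((a + 1 : ℕ) : ℝ) * p ^ a) * log p + p ^ (a + 1) * p⁻¹) / (a + 1)
          - (((a + 1 : ℕ) : ℝ) * p ^ a) / (a + 1) ^ 2) p :=
      (((hasDerivAt_pow (a + 1) p).mul (hasDerivAt_log hp0)).div_const _).sub
        ((hasDerivAt_pow (a + 1) p).div_const _)
    convert h1 using 1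
    · ext p; ring
    · push_cast
      field_simp
      ring
  rw [intervalIntegral.integral_eq_sub_of_hasDerivAt_of_le zero_le_one hc hd
    (by simpa using intervalIntegrable_pow_mul_log a 0)]
  simp
  ring

lemma integral_pow_mul_one_sub_pow_mul_log (a b : ℕ) :
    ∫ p in (0 : ℝ)..1, p ^ a * (1 - p) ^ b * log p =
      (a.factorial * b.factorial : ℝ) / (a + b + 1).factorial *
        ((harmonic a : ℝ) - harmonic (a + b + 1)) := by
  induction b generalizing a with
  | zero =>
    simp only [pow_zero, mul_one, integral_pow_mul_log, add_zero, harmonic_succ,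
      Nat.factorial_succ, Nat.factorial_zero]
    push_cast
    field_simp
    ring
  | succ b ih =>
    have h : ∀ p : ℝ, p ^ a * (1 - p) ^ (b + 1) * log p =
        p ^ a * (1 - p) ^ b * log p - p ^ (a + 1) * (1 - p) ^ b * log p := fun p => by ring
    simp_rw [h]
    rw [intervalIntegral.integral_sub (intervalIntegrable_pow_mul_log _ _)
      (intervalIntegrable_pow_mul_log _ _), ih, ih,
      show a + 1 + b + 1 = a + b + 1 + 1 by ring, show a + (b + 1) + 1 = a + b + 1 + 1 by ring,
      harmonic_succ (a + b + 1), harmonic_succ a]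
    simp only [Nat.factorial_succ]
    push_cast
    field_simp
    ring

lemma intervalIntegrable_pow_mul_log_one_sub (a b : ℕ) :
    IntervalIntegrable (fun p : ℝ => p ^ a * (1 - p) ^ b * log (1 - p)) volume 0 1 := by
  have := (intervalIntegrable_pow_mul_log b a).comp_sub_left 1
  simp only [sub_self, sub_zero, sub_sub_cancel] at this
  simpa only [mul_comm ((1 - _ : ℝ) ^ b)] using this.symm

lemma integral_pow_mul_one_sub_pow_mul_log_one_sub (a b : ℕ) :
    ∫ p in (0 : ℝ)..1, p ^ a * (1 - p) ^ b * log (1 - p) =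
      (a.factorial * b.factorial : ℝ) / (a + b + 1).factorial *
        ((harmonic b : ℝ) - harmonic (a + b + 1)) := by
  have h := intervalIntegral.integral_comp_sub_left (a := 0) (b := 1)
    (fun p : ℝ => p ^ b * (1 - p) ^ a * log p) 1
  simp only [sub_self, sub_zero, sub_sub_cancel] at h
  rw [integral_pow_mul_one_sub_pow_mul_log, add_comm b a] at h
  rw [mul_comm (a.factorial : ℝ), ← h]
  exact intervalIntegral.integral_congr fun p _ => by ring

/-- `-∫ f log (c f)` for the Beta density, in closed form. -/
lemma neg_integral_betaDensity_mul_log {n x : ℕ} (hx : x ≤ n) {c : ℝ} (hc : 0 < c) :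
    -∫ p : ℝ, betaDensity n x p * log (c * betaDensity n x p) =
      -log c - log (n + 1) - log (n.choose x) - x * harmonic x - (n - x : ℕ) * harmonic (n - x)
        + n * harmonic (n + 1) := by
  obtain ⟨y, rfl⟩ := Nat.exists_eq_add_of_le hx
  rw [Nat.add_sub_cancel_left]
  set K : ℝ := ((x + y : ℕ) + 1) * ((x + y).choose x : ℝ) with hK
  have hch : (0 : ℝ) < (x + y).choose x := by exact_mod_cast Nat.choose_pos (by omega)
  have hn : (0 : ℝ) < ((x + y : ℕ) : ℝ) + 1 := by positivity
  have hKpos : 0 < K := mul_pos hn hch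
  have hB : K * ((x.factorial * y.factorial : ℝ) / (x + y + 1).factorial) = 1 := by
    have h := Nat.add_choose_mul_factorial_mul_factorial x y
    rw [← Nat.choose_symm_add] at h
    have h' : ((x + y).choose x : ℝ) * x.factorial * y.factorial = (x + y).factorial := by
      exact_mod_cast h
    rw [Nat.factorial_succ, ← mul_div_assoc, div_eq_one_iff_eq (by positivity)]
    push_cast [← h', hK]
    ring
  have h1 : ∫ p : ℝ, betaDensity (x + y) x p * log (c * betaDensity (x + y) x p) =
      ∫ p in (0 : ℝ)..1, (K * log (c * K) * (p ^ x * (1 - p) ^ y)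
        + K * x * (p ^ x * (1 - p) ^ y * log p)
        + K * y * (p ^ x * (1 - p) ^ y * log (1 - p))) := by
    rw [intervalIntegral.integral_of_le zero_le_one, integral_Ioc_eq_integral_Ioo,
      ← setIntegral_eq_integral_of_forall_compl_eq_zero (s := Set.Icc 0 1),
      integral_Icc_eq_integral_Ioo]
    · refine setIntegral_congr_fun measurableSet_Ioo fun p hp => ?_
      have hp0 : 0 < p := hp.1
      have hp1 : 0 < 1 - p := sub_pos.2 hp.2
      have hb : betaDensity (x + y) x p = K * p ^ x * (1 - p) ^ y := by
        simp [betaDensity, hp.1.le, hp.2.le, hK]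
      simp only [hb]
      rw [show c * (K * p ^ x * (1 - p) ^ y) = (c * K) * p ^ x * (1 - p) ^ y by ring,
        log_mul (by positivity) (by positivity), log_mul (by positivity) (by positivity),
        log_pow, log_pow]
      ring
    · intro p hp
      have : betaDensity (x + y) x p = 0 := if_neg hp
      simp [this]
  have hi : IntervalIntegrable (fun p : ℝ => p ^ x * (1 - p) ^ y) volume 0 1 :=
    Continuous.intervalIntegrable (by fun_prop) _ _
  rw [h1, intervalIntegral.integral_add ((hi.const_mul _).add
      ((intervalIntegrable_pow_mul_log x y).const_mul _))
      ((intervalIntegrable_pow_mul_log_one_sub x y).const_mul _),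
    intervalIntegral.integral_add (hi.const_mul _)
      ((intervalIntegrable_pow_mul_log x y).const_mul _),
    intervalIntegral.integral_const_mul, intervalIntegral.integral_const_mul,
    intervalIntegral.integral_const_mul, integral_pow_mul_one_sub_pow,
    integral_pow_mul_one_sub_pow_mul_log, integral_pow_mul_one_sub_pow_mul_log_one_sub,
    log_mul hc.ne' hKpos.ne', hK, log_mul hn.ne' hch.ne', ← hK]
  push_cast
  linear_combination (-(log c + (log (x + y + 1) + log ((x + y).choose x)))
    - x * ((harmonic x : ℝ) - harmonic (x + y + 1))
    - y * ((harmonic y : ℝ) - harmonic (x + y + 1))) * hB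

lemma tendsto_mul_harmonic_sub_log_sub_eulerMascheroni :
    Tendsto (fun m : ℕ => (m : ℝ) * (harmonic m - log m - eulerMascheroniConstant)) atTop
      (nhds (1 / 2)) := by
  have hlim := tendsto_harmonic_sub_log
  have hinv : Tendsto (fun m : ℕ => 1 / (2 * ((m : ℝ) + 1))) atTop (nhds 0) := by
    have := (tendsto_one_div_add_atTop_nhds_zero_nat (𝕜 := ℝ)).const_mul (1 / 2)
    simpa [mul_comm] using this
  have hinv' : Tendsto (fun m : ℕ => 1 / (2 * (((m + 1 : ℕ) : ℝ) + 1))) atTop (nhds 0) :=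
    hinv.comp (tendsto_add_atTop_nat 1)
  have hlim1 := hlim.comp (tendsto_add_atTop_nat 1)
  have hlogstep : ∀ m : ℕ, log ((m + 1 + 1 : ℕ) : ℝ) =
      log ((m + 1 : ℕ) : ℝ) + log (1 + 1 / ((m : ℝ) + 1)) := fun m => by
    rw [← log_mul (by positivity) (by positivity)]
    congr 1
    push_cast
    field_simp
  have hupper : ∀ m : ℕ, (harmonic (m + 1) : ℝ) - log ((m + 1 : ℕ) : ℝ) - 1 / (2 * ((m : ℝ) + 1))
      ≤ eulerMascheroniConstant := by
    have hmono : Monotone fun m : ℕ =>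
        (harmonic (m + 1) : ℝ) - log ((m + 1 : ℕ) : ℝ) - 1 / (2 * ((m : ℝ) + 1)) := by
      refine monotone_nat_of_le_succ fun m => ?_
      have h1 : (1 : ℝ) ≤ 1 + 1 / ((m : ℝ) + 1) := by
        have : (0 : ℝ) ≤ 1 / ((m : ℝ) + 1) := by positivity
        linarith
      have h2 := self_le_sinh_iff.2 (log_nonneg h1)
      rw [sinh_log (by positivity)] at h2
      have h3 : ((1 + 1 / ((m : ℝ) + 1)) - (1 + 1 / ((m : ℝ) + 1))⁻¹) / 2 =
          1 / (2 * ((m : ℝ) + 1)) + 1 / (2 * ((m : ℝ) + 2)) := by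
        field_simp
        ring
      have h4 : (1 : ℝ) / (2 * ((m : ℝ) + 2)) = (m + 2 : ℝ)⁻¹ - 1 / (2 * (m + 2)) := by
        field_simp
        norm_num
      rw [hlogstep, harmonic_succ (m + 1)]
      push_cast
      rw [show (m : ℝ) + 1 + 1 = m + 2 by ring]
      linarith
    refine fun m => hmono.ge_of_tendsto ?_ m
    simpa [Function.comp_def] using hlim1.sub hinv
  have hlower : ∀ m : ℕ, eulerMascheroniConstant ≤
      (harmonic (m + 1) : ℝ) - log ((m + 1 : ℕ) : ℝ) - 1 / (2 * (((m + 1 : ℕ) : ℝ) + 1)) := by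
    have hanti : Antitone fun m : ℕ =>
        (harmonic (m + 1) : ℝ) - log ((m + 1 : ℕ) : ℝ) - 1 / (2 * (((m + 1 : ℕ) : ℝ) + 1)) := by
      refine antitone_nat_of_succ_le fun m => ?_
      have h2 := le_log_one_add_of_nonneg (x := 1 / ((m : ℝ) + 1)) (by positivity)
      have h3 : 2 * (1 / ((m : ℝ) + 1)) / (1 / ((m : ℝ) + 1) + 2) = 2 / (2 * m + 3) := by
        field_simp
        ring
      have h4 : (m + 2 : ℝ)⁻¹ + 1 / (2 * (m + 2)) - 1 / (2 * (m + 3)) ≤ 2 / (2 * m + 3) := by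
        rw [← sub_nonneg]
        have : 2 / (2 * m + 3) - ((m + 2 : ℝ)⁻¹ + 1 / (2 * (m + 2)) - 1 / (2 * (m + 3))) =
            3 / (2 * (2 * m + 3) * (m + 2) * (m + 3)) := by
          field_simp
          ring
        rw [this]
        positivity
      rw [hlogstep, harmonic_succ (m + 1)]
      push_cast
      rw [show (m : ℝ) + 1 + 1 = m + 2 by ring, show (m : ℝ) + 2 + 1 = m + 3 by ring]
      linarith
    refine fun m => hanti.le_of_tendsto ?_ m
    simpa only [Function.comp_def, sub_zero] using hlim1.sub hinv'
  rw [← tendsto_add_atTop_iff_nat 1]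
  have hl : Tendsto (fun m : ℕ => 1 / 2 - 1 / (2 * (((m + 1 : ℕ) : ℝ) + 1))) atTop
      (nhds (1 / 2)) := by
    simpa only [sub_zero] using hinv'.const_sub (1 / 2)
  refine tendsto_of_tendsto_of_tendsto_of_le_of_le hl tendsto_const_nhds (fun m => ?_) fun m => ?_
  · have h := mul_le_mul_of_nonneg_left (hlower m) (Nat.cast_nonneg (α := ℝ) (m + 1))
    have e : ((m + 1 : ℕ) : ℝ) * (1 / (2 * (((m + 1 : ℕ) : ℝ) + 1))) =
        1 / 2 - 1 / (2 * (((m + 1 : ℕ) : ℝ) + 1)) := by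
      field_simp
      ring
    simp only
    linarith
  · have h := mul_le_mul_of_nonneg_left (hupper m) (Nat.cast_nonneg (α := ℝ) (m + 1))
    have e : ((m + 1 : ℕ) : ℝ) * (1 / (2 * ((m : ℝ) + 1))) = 1 / 2 := by
      push_cast
      field_simp
    simp only
    linarith

lemma tendsto_log_factorial_sub_mul_harmonic :
    Tendsto (fun m : ℕ => log m.factorial - m * harmonic m
      + (1 + eulerMascheroniConstant) * m - 1 / 2 * log m) atTop
      (nhds (1 / 2 * log (2 * π) - 1 / 2)) := by
  have h1 := (Stirling.tendsto_stirlingSeq_sqrt_pi.log (by positivity)).sub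
    tendsto_mul_harmonic_sub_log_sub_eulerMascheroni
  have h2 := h1.add_const (1 / 2 * log 2)
  have e : log √π - 1 / 2 + 1 / 2 * log 2 = 1 / 2 * log (2 * π) - 1 / 2 := by
    rw [log_sqrt pi_pos.le, log_mul two_ne_zero pi_ne_zero]
    ring
  rw [e] at h2
  refine h2.congr' ?_
  filter_upwards [eventually_gt_atTop 0] with m hm
  have hm' : (m : ℝ) ≠ 0 := by positivity
  rw [Stirling.log_stirlingSeq_formula, log_mul two_ne_zero hm', log_div hm' (exp_ne_zero _),
    log_exp]
  ring

lemma diffEntropy_betaDensity {n x : ℕ} (hx : x ≤ n) :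
    diffEntropy (betaDensity n x) =
      -log (n + 1) - log (n.choose x) - x * harmonic x - (n - x : ℕ) * harmonic (n - x)
        + n * harmonic (n + 1) := by
  simpa [diffEntropy] using neg_integral_betaDensity_mul_log hx one_pos

lemma diffEntropy_affine (f : ℝ → ℝ) {c : ℝ} (hc : 0 < c) (m : ℝ) :
    diffEntropy (fun z => c * f (m + c * z)) = -∫ p, f p * log (c * f p) := by
  have h1 := Measure.integral_comp_mul_left (fun u => f (m + u) * log (c * f (m + u))) c
  rw [integral_add_left_eq_self (fun u => f u * log (c * f u)) m, abs_of_pos (inv_pos.2 hc),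
    smul_eq_mul] at h1
  simp only [diffEntropy, mul_assoc]
  rw [integral_const_mul, h1, mul_inv_cancel_left₀ hc.ne']

lemma diffEntropy_tildeDensityBeta {β : ℝ} {n : ℕ} (hn : 0 < n) (hx : ⌊(n : ℝ) ^ β⌋₊ ≤ n) :
    diffEntropy (tildeDensityBeta β n) =
      diffEntropy (betaDensity n ⌊(n : ℝ) ^ β⌋₊) + (1 - β / 2) * log n := by
  have hn' : (0 : ℝ) < n := by exact_mod_cast hn
  have hc : 0 < (n : ℝ) ^ (β / 2 - 1) := rpow_pos_of_pos hn' _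
  have h := diffEntropy_affine (betaDensity n ⌊(n : ℝ) ^ β⌋₊) hc ((n : ℝ) ^ (β - 1))
  rw [neg_integral_betaDensity_mul_log hx hc, log_rpow hn'] at h
  rw [diffEntropy_betaDensity hx]
  unfold tildeDensityBeta
  rw [h]
  ring

/-- Second order expansion of the entropy of the Beta density: if `x_n` and `n - x_n` both tend to
infinity, the entropy is that of a Gaussian of variance `x_n (n - x_n) / n³`, up to `o(1)`. -/
lemma tendsto_diffEntropy_betaDensity_sub {x : ℕ → ℕ} (hle : ∀ᶠ n in atTop, x n ≤ n)
    (hx : Tendsto x atTop atTop) (hy : Tendsto (fun n => n - x n) atTop atTop) :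
    Tendsto (fun n : ℕ => diffEntropy (betaDensity n (x n)) -
      1 / 2 * (log (x n) + log (n - x n : ℕ) - 3 * log n)) atTop
      (nhds (1 / 2 * log (2 * π * exp 1))) := by
  have hG := tendsto_log_factorial_sub_mul_harmonic
  have hq : Tendsto (fun n : ℕ => (n : ℝ) / (n + 1)) atTop (nhds 1) :=
    tendsto_natCast_div_add_atTop 1
  have hmain := (((hG.comp hx).add (hG.comp hy)).sub hG).add (hq.add (hq.log one_ne_zero))
  have e : 1 / 2 * log (2 * π) - 1 / 2 + (1 / 2 * log (2 * π) - 1 / 2)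
      - (1 / 2 * log (2 * π) - 1 / 2) + (1 + log 1) = 1 / 2 * log (2 * π * exp 1) := by
    rw [log_mul (by positivity) (exp_ne_zero _), log_exp, log_one]
    ring
  rw [e] at hmain
  refine hmain.congr' ?_
  filter_upwards [hle, eventually_gt_atTop 0] with n hn hn0
  have hn' : (0 : ℝ) < n := by exact_mod_cast hn0
  rw [diffEntropy_betaDensity hn, Nat.choose_eq_factorial_div_factorial hn,
    Nat.cast_div (Nat.factorial_mul_factorial_dvd_factorial hn) (by positivity),
    Nat.cast_mul, log_div hn'.ne' (by positivity), log_div (by positivity) (by positivity),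
    log_mul (by positivity) (by positivity), harmonic_succ]
  simp only [Function.comp_apply]
  push_cast [Nat.cast_sub hn]
  field_simp
  ring

/-- For `β ∈ (0,1)` and `x_n = ⌊n^β⌋`,
`h(f_{n,x_n}) - (1/2) log(2πe (1-n^{β-1})/n^{2-β}) → 0`; equivalently, the differential entropy
of the standardized variable `Z̃_n = n^{1-β/2}(Z_n - n^{β-1})` converges to `(1/2) log(2πe)`. -/
theorem entropy_asymptotics_beta (β : ℝ) (hβ : β ∈ Set.Ioo (0 : ℝ) 1) :
    Tendsto (fun n : ℕ =>
        diffEntropy (betaDensity n (Nat.floor ((n : ℝ) ^ β))) -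
          (1 / 2) * Real.log (2 * Real.pi * Real.exp 1 * (1 - (n : ℝ) ^ (β - 1)) /
            (n : ℝ) ^ (2 - β))) atTop
      (nhds 0) ∧
    Tendsto (fun n : ℕ => diffEntropy (tildeDensityBeta β n)) atTop
      (nhds ((1 / 2) * Real.log (2 * Real.pi * Real.exp 1))) := by
  obtain ⟨hβ0, hβ1⟩ := hβ
  set x : ℕ → ℕ := fun n => ⌊(n : ℝ) ^ β⌋₊ with hxdef
  have hpow : Tendsto (fun n : ℕ => (n : ℝ) ^ β) atTop atTop :=
    (tendsto_rpow_atTop hβ0).comp tendsto_natCast_atTop_atTop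
  have hx : Tendsto x atTop atTop := tendsto_nat_floor_atTop.comp hpow
  have hxratio : Tendsto (fun n : ℕ => (x n : ℝ) / (n : ℝ) ^ β) atTop (nhds 1) :=
    (tendsto_nat_floor_div_atTop (R := ℝ)).comp hpow
  have hsmall : Tendsto (fun n : ℕ => (n : ℝ) ^ (β - 1)) atTop (nhds 0) := by
    have := (tendsto_rpow_neg_atTop (sub_pos.2 hβ1)).comp (tendsto_natCast_atTop_atTop (R := ℝ))
    simpa only [neg_sub, Function.comp_def] using this
  have hle : ∀ n : ℕ, 0 < n → x n ≤ n := fun n hn => by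
    refine Nat.floor_le_of_le ?_
    calc (n : ℝ) ^ β ≤ (n : ℝ) ^ (1 : ℝ) :=
          rpow_le_rpow_of_exponent_le (by exact_mod_cast hn) hβ1.le
      _ = n := rpow_one _
  have hyratio : Tendsto (fun n : ℕ => ((n - x n : ℕ) : ℝ) / n) atTop (nhds 1) := by
    have h := (hxratio.mul hsmall).const_sub 1
    rw [mul_zero, sub_zero] at h
    refine h.congr' ?_
    filter_upwards [eventually_gt_atTop 0] with n hn
    have hn' : (0 : ℝ) < n := by exact_mod_cast hn
    have := rpow_pos_of_pos hn' β
    rw [Nat.cast_sub (hle n hn), rpow_sub hn', rpow_one]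
    field_simp
  have hy : Tendsto (fun n => n - x n) atTop atTop := by
    rw [← tendsto_natCast_atTop_iff (R := ℝ)]
    refine (hyratio.pos_mul_atTop one_pos (tendsto_natCast_atTop_atTop (R := ℝ))).congr' ?_
    filter_upwards [eventually_gt_atTop 0] with n hn
    field_simp
  have hent := tendsto_diffEntropy_betaDensity_sub
    ((eventually_gt_atTop 0).mono hle) hx hy
  have hlog1 : Tendsto (fun n : ℕ => log (1 - (n : ℝ) ^ (β - 1))) atTop (nhds 0) := by
    simpa using (hsmall.const_sub 1).log (by norm_num)
  have htilde : Tendsto (fun n : ℕ => diffEntropy (tildeDensityBeta β n)) atTop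
      (nhds (1 / 2 * log (2 * π * exp 1))) := by
    have h := hent.add (((hxratio.log one_ne_zero).add (hyratio.log one_ne_zero)).const_mul (1 / 2))
    rw [log_one, add_zero, mul_zero, add_zero] at h
    refine h.congr' ?_
    filter_upwards [eventually_gt_atTop 0, hx.eventually_gt_atTop 0, hy.eventually_gt_atTop 0]
      with n hn hxn hyn
    have hn' : (0 : ℝ) < n := by exact_mod_cast hn
    have hxn' : (0 : ℝ) < x n := by exact_mod_cast hxn
    have hyn' : (0 : ℝ) < (n - x n : ℕ) := by exact_mod_cast hyn
    rw [diffEntropy_tildeDensityBeta hn (hle n hn), log_div hxn'.ne' (rpow_pos_of_pos hn' _).ne',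
      log_div hyn'.ne' hn'.ne', log_rpow hn']
    ring
  refine ⟨?_, htilde⟩
  have h := (htilde.sub_const (1 / 2 * log (2 * π * exp 1))).sub (hlog1.const_mul (1 / 2))
  rw [sub_self, mul_zero, sub_zero] at h
  refine h.congr' ?_
  filter_upwards [eventually_gt_atTop 0, hsmall.eventually_lt_const one_pos] with n hn hlt
  have hn' : (0 : ℝ) < n := by exact_mod_cast hn
  rw [diffEntropy_tildeDensityBeta hn (hle n hn), log_div
    (mul_pos (by positivity) (sub_pos.2 hlt)).ne' (rpow_pos_of_pos hn' _).ne',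
    log_mul (by positivity) (sub_pos.2 hlt).ne', log_rpow hn']
  ring
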